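/- Uniqueness of the factor: if Ξ : E → ℂ is continuous, for every y ∈ E the function s ↦ Ξ(s•y)/s is Lebesgue integrable on (0,1), and Φ : E → ℂ is defined by Φ(y) = Ξ(y) + (ℐΞ)(y), then for every y ∈ E one has Φ(y) − (𝒥Φ)(y) = Ξ(y). -/

import Mathlib

open MeasureTheory Set

/-- Dilating the argument turns `∫₀¹ g(st)/s ds` into the primitive `∫₀ᵗ g(u)/u du`. -/
lemma integral_dilation_div (g : ℝ → ℂ) {t : ℝ} (ht : t ≠ 0) :
    ∫ s in (0:ℝ)..1, g (s * t) / (s : ℂ) = ∫ u in (0:ℝ)..t, g u / (u : ℂ) := by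
  have h := intervalIntegral.smul_integral_comp_mul_right
    (f := fun u : ℝ => g u / (u : ℂ)) (a := 0) (b := 1) t
  rw [zero_mul, one_mul] at h
  rw [← h, ← intervalIntegral.integral_smul]
  refine intervalIntegral.integral_congr fun s _ => ?_
  have ht' : (t : ℂ) ≠ 0 := by exact_mod_cast ht
  simp only [Complex.real_smul, Complex.ofReal_mul]
  rw [mul_comm (s : ℂ), mul_div_assoc', mul_div_mul_left _ _ ht']

/-- Integration by parts for `t ↦ t * ∫₀ᵗ g(u)/u du` on `[0, 1]`. -/
lemma integral_add_primitive_div (g : ℝ → ℂ) (hg : Continuous g)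
    (hint : IntervalIntegrable (fun u : ℝ => g u / (u : ℂ)) volume 0 1) :
    ∫ t in (0:ℝ)..1, (g t + ∫ u in (0:ℝ)..t, g u / (u : ℂ)) =
      ∫ u in (0:ℝ)..1, g u / (u : ℂ) := by
  have hF : ContinuousOn (fun t => ∫ u in (0:ℝ)..t, g u / (u : ℂ)) (Icc 0 1) := by
    simpa [uIcc_of_le zero_le_one] using
      intervalIntegral.continuousOn_primitive_interval' hint left_mem_uIcc
  have hderiv : ∀ t ∈ Ioo (0:ℝ) 1,
      HasDerivAt (fun t : ℝ => (t : ℂ) * ∫ u in (0:ℝ)..t, g u / (u : ℂ))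
        (g t + ∫ u in (0:ℝ)..t, g u / (u : ℂ)) t := by
    intro t ht
    have ht0 : (t : ℂ) ≠ 0 := by exact_mod_cast ht.1.ne'
    have hd := intervalIntegral.integral_hasDerivAt_right
      (hint.mono_set (by
        rw [uIcc_of_le ht.1.le, uIcc_of_le zero_le_one]
        exact Icc_subset_Icc_right ht.2.le))
      (Measurable.stronglyMeasurable
        (hg.measurable.div Complex.measurable_ofReal)).stronglyMeasurableAtFilter
      (hg.continuousAt.div Complex.continuous_ofReal.continuousAt ht0)
    refine ((Complex.ofRealCLM.hasDerivAt (x := t)).mul hd).congr_deriv ?_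
    rw [Complex.ofRealCLM_apply, Complex.ofRealCLM_apply, Complex.ofReal_one, one_mul,
      mul_div_cancel₀ _ ht0, add_comm]
  rw [intervalIntegral.integral_eq_sub_of_hasDerivAt_of_le zero_le_one
    (Complex.continuous_ofReal.continuousOn.mul hF) hderiv
    ((hg.continuousOn.add hF).intervalIntegrable_of_Icc zero_le_one)]
  simp

/-- Uniqueness of the factor: if `Ξ : E → ℂ` is continuous, for
every `y ∈ E` the function `s ↦ Ξ(s•y)/s` is Lebesgue integrable on `(0,1)`,
and `Φ : E → ℂ` is defined by `Φ(y) = Ξ(y) + (ℐΞ)(y)`, then for every `y ∈ E`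
one has `Φ(y) − (𝒥Φ)(y) = Ξ(y)`. -/
theorem uniqueness_of_factor {E : Type*} [NormedAddCommGroup E] [NormedSpace ℝ E]
    (Ξ : E → ℂ) (hΞ : Continuous Ξ)
    (hint : ∀ y : E, IntegrableOn (fun s : ℝ => Ξ (s • y) / (s : ℂ)) (Ioo 0 1))
    (Φ : E → ℂ) (hΦ : Φ = fun y => Ξ y + ∫ s in Ioo (0:ℝ) 1, Ξ (s • y) / (s : ℂ)) :
    ∀ y : E, Φ y - (∫ t in Ioo (0:ℝ) 1, Φ (t • y)) = Ξ y := by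
  intro y
  have hIoo : ∀ f : ℝ → ℂ, ∫ s in Ioo (0:ℝ) 1, f s = ∫ s in (0:ℝ)..1, f s := fun f => by
    rw [intervalIntegral.integral_of_le zero_le_one, integral_Ioc_eq_integral_Ioo]
  have hg : Continuous fun t : ℝ => Ξ (t • y) := by fun_prop
  have hJ : ∫ t in Ioo (0:ℝ) 1, Φ (t • y) = ∫ s in Ioo (0:ℝ) 1, Ξ (s • y) / (s : ℂ) := by
    rw [hIoo (fun s => Ξ (s • y) / (s : ℂ)),
      ← integral_add_primitive_div _ hg
        ((intervalIntegrable_iff_integrableOn_Ioo_of_le zero_le_one).2 (hint y)), ← hIoo]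
    refine setIntegral_congr_fun measurableSet_Ioo fun t ht => ?_
    simp only [hΦ, hIoo, smul_smul]
    rw [integral_dilation_div (fun t => Ξ (t • y)) ht.1.ne']
  rw [hJ, hΦ]
  ring
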